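/- Let p, q be integers such that 5 does not divide p and p + q ≡ 0 (mod 5), and let n ≥ 1. Then the generalized Fibonacci–Lucas quaternion G^{p,q}_n is a zero divisor in H[Z_5] (equivalently, not a unit) if and only if n ≡ 0 (mod 5). -/

import Mathlib

open Quaternion

/-- The Lucas sequence, as integers: `l_n = 2·f_{n+1} - f_n`
(equivalently `l_0 = 2`, `l_1 = 1`, `l_{n+2} = l_{n+1} + l_n`). -/
def lucas (n : ℕ) : ℤ := 2 * (Nat.fib (n + 1) : ℤ) - (Nat.fib n : ℤ)

/-- The generalized Fibonacci–Lucas numbers `g^{p,q}_n = p·f_{n-1} + q·l_n` (for `n ≥ 1`). -/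
def genFL (p q : ℤ) (n : ℕ) : ℤ := p * (Nat.fib (n - 1) : ℤ) + q * lucas n

/-- The n-th generalized Fibonacci–Lucas quaternion over a commutative ring `R`:
`G^{p,q}_n = g^{p,q}_n + g^{p,q}_{n+1}·i + g^{p,q}_{n+2}·j + g^{p,q}_{n+3}·k` in `ℍ[R]`. -/
def genFLQuat (R : Type*) [CommRing R] (p q : ℤ) (n : ℕ) : ℍ[R] :=
  ⟨(genFL p q n : R), (genFL p q (n + 1) : R), (genFL p q (n + 2) : R), (genFL p q (n + 3) : R)⟩

theorem Quaternion.isUnit_iff_isUnit_normSq {R : Type*} [CommRing R] (x : ℍ[R]) :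
    IsUnit x ↔ IsUnit (normSq x) := by
  refine ⟨fun h => h.map normSq, fun h => ?_⟩
  obtain ⟨c, hc⟩ := h.exists_right_inv
  have hc' : ((normSq x : R) : ℍ[R]) * (c : ℍ[R]) = 1 := by
    rw [← coe_mul, hc, coe_one]
  refine isUnit_iff_exists.2 ⟨star x * (c : ℍ[R]), ?_, ?_⟩
  · rw [← mul_assoc, self_mul_star, hc']
  · rw [mul_assoc, coe_commutes, ← mul_assoc, star_mul_self, hc']

theorem Nat.five_dvd_fib_iff (m : ℕ) : 5 ∣ Nat.fib m ↔ 5 ∣ m := by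
  refine ⟨fun h => ?_, fun h => Nat.fib_dvd 5 m h⟩
  by_contra hm
  have hcop : Nat.gcd 5 m = 1 := (Nat.Prime.coprime_iff_not_dvd (by norm_num)).2 hm
  have hfib := Nat.fib_gcd 5 m
  rw [hcop, Nat.fib_one, show Nat.fib 5 = 5 from rfl, Nat.gcd_eq_left h] at hfib
  omega

theorem Nat.sum_four_fib_sq (n : ℕ) :
    Nat.fib n ^ 2 + Nat.fib (n + 1) ^ 2 + Nat.fib (n + 2) ^ 2 + Nat.fib (n + 3) ^ 2 =
      3 * Nat.fib (2 * n + 3) := by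
  rw [show 2 * n + 3 = 2 * (n + 1) + 1 by ring, Nat.fib_two_mul_add_one,
    show n + 3 = n + 1 + 2 by rfl, Nat.fib_add_two (n := n + 1), show n + 1 + 1 = n + 2 by rfl,
    Nat.fib_add_two (n := n)]
  ring

theorem genFL_succ (p q : ℤ) (m : ℕ) :
    genFL p q (m + 1) = (p + q) * Nat.fib m + q * Nat.fib (m + 2)  := by
  simp only [genFL, lucas, Nat.add_sub_cancel, Nat.fib_add_two]
  push_cast
  ring

theorem genFL_cast_of_add_eq_zero {R : Type*} [CommRing R] {p q : ℤ} (h : ((p + q : ℤ) : R) = 0)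
    (m : ℕ) : (genFL p q (m + 1) : R) = q * Nat.fib (m + 2) := by
  rw [genFL_succ, Int.cast_add, Int.cast_mul, h]
  simp

theorem normSq_genFLQuat_of_add_eq_zero {R : Type*} [CommRing R] {p q : ℤ}
    (h : ((p + q : ℤ) : R) = 0) (m : ℕ) :
    normSq (genFLQuat R p q (m + 1)) = (q : R) ^ 2 * (3 * Nat.fib (2 * m + 7)) := by
  have hsum := congrArg (Nat.cast : ℕ → R) (Nat.sum_four_fib_sq (m + 2))
  push_cast at hsum
  rw [show 2 * m + 7 = 2 * (m + 2) + 3 by ring, ← hsum, normSq_def']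
  simp only [genFLQuat, add_right_comm m 1, genFL_cast_of_add_eq_zero h]
  simp only [add_right_comm m _ 2]
  ring

theorem genFLQuat_zmod_five_p_add_q (p q : ℤ) (hp : ¬ (5 : ℤ) ∣ p) (hpq : (p + q) % 5 = 0)
    (n : ℕ) (hn : 1 ≤ n) :
    ¬ IsUnit (genFLQuat (ZMod 5) p q n) ↔ n % 5 = 0 := by
  have hthree : (3 : ZMod 5) ≠ 0 := by decide
  have : Fact (Nat.Prime 5) := ⟨by norm_num⟩
  obtain ⟨m, rfl⟩ := Nat.exists_eq_add_of_le' hn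
  have hadd : ((p + q : ℤ) : ZMod 5) = 0 :=
    (ZMod.intCast_zmod_eq_zero_iff_dvd _ 5).2 (Int.dvd_of_emod_eq_zero hpq)
  have hq : (q : ZMod 5) ≠ 0 := by
    rw [Ne, ZMod.intCast_zmod_eq_zero_iff_dvd]
    omega
  rw [Quaternion.isUnit_iff_isUnit_normSq, isUnit_iff_ne_zero, not_not,
    normSq_genFLQuat_of_add_eq_zero hadd, mul_eq_zero_iff_left (pow_ne_zero 2 hq),
    mul_eq_zero_iff_left hthree, ZMod.natCast_eq_zero_iff, Nat.five_dvd_fib_iff]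
  omega
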